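/- Let (z,w) be a two-reflector of type A (i.e., z(x) = sup_{p∈T} k_{p,w(p)}(x) and w(p) = inf_{x∈Ω} h_{x,z(x)}(p)), normalized so that z(x₀) = 0 for some x₀ ∈ Ω. Then ‖z‖_∞ ≤ K·diam(Ω) and -β/2 - K·diam(Ω) ≤ w(p) ≤ max_{q∈T}(|x₀-q|² - β²)/(2β), where K = sup_{x∈Ω,p∈T}|x-p|/β. -/

import Mathlib

theorem stmt_12 {n : ℕ} (Ω T : Set (EuclideanSpace ℝ (Fin n)))
    (hΩc : IsCompact Ω) (hΩne : Ω.Nonempty) (hTc : IsCompact T) (hTne : T.Nonempty)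
    (β : ℝ) (hβ : 0 < β) (z w : EuclideanSpace ℝ (Fin n) → ℝ)
    (hzc : ContinuousOn z Ω) (hwc : ContinuousOn w T)
    (hz : ∀ x ∈ Ω, z x = sSup ((fun p => (β ^ 2 - ‖x - p‖ ^ 2) / (2 * β) + w p) '' T))
    (hw : ∀ p ∈ T, w p = sInf ((fun x => (‖x - p‖ ^ 2 - β ^ 2) / (2 * β) + z x) '' Ω))
    (x₀ : EuclideanSpace ℝ (Fin n)) (hx₀ : x₀ ∈ Ω) (hnorm : z x₀ = 0)
    (K : ℝ)
    (hK : K = sSup ((fun q : (EuclideanSpace ℝ (Fin n)) × (EuclideanSpace ℝ (Fin n)) =>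
        ‖q.1 - q.2‖) '' (Ω ×ˢ T)) / β) :
    (∀ x ∈ Ω, |z x| ≤ K * Metric.diam Ω) ∧
      (∀ p ∈ T, -β / 2 - K * Metric.diam Ω ≤ w p ∧
        w p ≤ sSup ((fun q => (‖x₀ - q‖ ^ 2 - β ^ 2) / (2 * β)) '' T)) := by
  have bz : ∀ x, BddAbove ((fun p => (β ^ 2 - ‖x - p‖ ^ 2) / (2 * β) + w p) '' T) := by
    intro x
    apply hTc.bddAbove_image
    exact ContinuousOn.add (Continuous.continuousOn (by fun_prop)) hwc
  have bw : ∀ p, BddBelow ((fun x => (‖x - p‖ ^ 2 - β ^ 2) / (2 * β) + z x) '' Ω) := by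
    intro p
    apply hΩc.bddBelow_image
    exact ContinuousOn.add (Continuous.continuousOn (by fun_prop)) hzc
  have bs : BddAbove ((fun q => (‖x₀ - q‖ ^ 2 - β ^ 2) / (2 * β)) '' T) := by
    apply hTc.bddAbove_image
    exact Continuous.continuousOn (by fun_prop)
  have bK : BddAbove ((fun q : (EuclideanSpace ℝ (Fin n)) × (EuclideanSpace ℝ (Fin n)) =>
        ‖q.1 - q.2‖) '' (Ω ×ˢ T)) := by
    apply (hΩc.prod hTc).bddAbove_image
    exact Continuous.continuousOn (by fun_prop)
  have hM : ∀ x ∈ Ω, ∀ p ∈ T, ‖x - p‖ ≤ K * β := by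
    intro x hx p hp
    rw [hK, div_mul_cancel₀ _ hβ.ne']
    exact le_csSup bK ⟨(x, p), ⟨hx, hp⟩, rfl⟩
  have key : ∀ x ∈ Ω, ∀ y ∈ Ω, z x ≤ z y + K * Metric.diam Ω := by
    intro x hx y hy
    rw [hz x hx]
    apply csSup_le (hTne.image _)
    rintro _ ⟨p, hp, rfl⟩
    have h1 : (β ^ 2 - ‖y - p‖ ^ 2) / (2 * β) + w p ≤ z y := by
      rw [hz y hy]
      exact le_csSup (bz y) ⟨p, hp, rfl⟩
    have h2 : ‖y - p‖ - ‖x - p‖ ≤ Metric.diam Ω := by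
      have := Metric.dist_le_diam_of_mem hΩc.isBounded hy hx
      rw [dist_eq_norm] at this
      have h3 := norm_sub_norm_le (y - p) (x - p)
      rw [sub_sub_sub_cancel_right] at h3
      linarith
    have hd : 0 ≤ Metric.diam Ω := Metric.diam_nonneg
    have h4 := hM x hx p hp
    have h5 := hM y hy p hp
    have h6 : (‖y - p‖ - ‖x - p‖) * (‖y - p‖ + ‖x - p‖) ≤ Metric.diam Ω * (2 * (K * β)) :=
      mul_le_mul h2 (by linarith) (by positivity) hd
    have h7 : (β ^ 2 - ‖x - p‖ ^ 2) / (2 * β) - (β ^ 2 - ‖y - p‖ ^ 2) / (2 * β)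
        ≤ K * Metric.diam Ω := by
      rw [← sub_div, div_le_iff₀ (by positivity)]
      nlinarith
    simp only
    linarith
  have hzb : ∀ x ∈ Ω, |z x| ≤ K * Metric.diam Ω := by
    intro x hx
    have h1 := key x hx x₀ hx₀
    have h2 := key x₀ hx₀ x hx
    rw [abs_le]
    constructor <;> linarith
  refine ⟨hzb, fun p hp => ⟨?_, ?_⟩⟩
  · rw [hw p hp]
    apply le_csInf (hΩne.image _)
    rintro _ ⟨x, hx, rfl⟩
    have h1 := (abs_le.1 (hzb x hx)).1
    have h2 : -β / 2 ≤ (‖x - p‖ ^ 2 - β ^ 2) / (2 * β) := by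
      rw [le_div_iff₀ (by positivity)]
      nlinarith [sq_nonneg ‖x - p‖]
    simp only
    linarith
  · have h1 : w p ≤ (‖x₀ - p‖ ^ 2 - β ^ 2) / (2 * β) + z x₀ := by
      rw [hw p hp]
      exact csInf_le (bw p) ⟨x₀, hx₀, rfl⟩
    rw [hnorm, add_zero] at h1
    exact h1.trans (le_csSup bs ⟨p, hp, rfl⟩)
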